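/- Let n ≥ 1, let f : ℝⁿ → ℝ be smooth, fix x₀ ∈ ℝⁿ, R ≥ 2, K ≥ 0, t₀ ∈ ℝ, T > 0, a ≥ 0 and D > 0. Assume ⟨Hess f(x) v, v⟩ ≥ −(n−1)K|v|² for all x in the ball B(x₀,R) and all v ∈ ℝⁿ, and let u be a smooth function on Q_{R,T} = B(x₀,R) × [t₀−T,t₀] with 0 < u ≤ D solving the nonlinear f-heat equation ∂u/∂t = Δ_f u + a·u·ln u. Then there exists a constant c depending only on n such that for all (x,t) ∈ B(x₀,R/2) × (t₀−T, t₀], |∇u|(x,t)/√(u(x,t)) ≤ c·√D·( 1/R + √(|α|/R) + 1/√(t−t₀+T) + √K + √(c₁) ), where c₁ = max{2(n−1)K + a(2 + ln D), 0} and α = max_{|x−x₀|=1} ( (n−1) − ⟨∇f(x), x−x₀⟩ ). (This is the Euclidean-space case of the paper's Theorem 1.1(i), Hamilton-type gradient estimate for the nonlinear f-heat equation.) -/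

import Mathlib

open Metric Set
open scoped RealInnerProductSpace

noncomputable section

/-- Euclidean Laplacian on `EuclideanSpace ℝ (Fin n)`. -/
def eLap {n : ℕ} (u : EuclideanSpace ℝ (Fin n) → ℝ) (x : EuclideanSpace ℝ (Fin n)) : ℝ :=
  ∑ i : Fin n,
    fderiv ℝ (fun y => fderiv ℝ u y (EuclideanSpace.single i 1)) x (EuclideanSpace.single i 1)

/-- Weighted (drift) Laplacian `Δ_f u = Δu − ⟨∇f, ∇u⟩`. -/
def fLap {n : ℕ} (f u : EuclideanSpace ℝ (Fin n) → ℝ) (x : EuclideanSpace ℝ (Fin n)) : ℝ :=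
  eLap u x - ⟪gradient f x, gradient u x⟫

/-- Hessian quadratic form of `f` at `x` evaluated at `(v, v)`. -/
def hessQF {n : ℕ} (f : EuclideanSpace ℝ (Fin n) → ℝ) (x v : EuclideanSpace ℝ (Fin n)) : ℝ :=
  fderiv ℝ (fun y => fderiv ℝ f y v) x v

/-- The constant `α = max_{|x−x₀|=1} ((n−1) − ⟨∇f(x), x−x₀⟩)`. -/
def alphaC {n : ℕ} (f : EuclideanSpace ℝ (Fin n) → ℝ) (x₀ : EuclideanSpace ℝ (Fin n)) : ℝ :=
  sSup ((fun y => (n : ℝ) - 1 - ⟪gradient f y, y - x₀⟫) '' sphere x₀ 1)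

/-- Directional derivative. -/
def dd {P : Type*} [NormedAddCommGroup P] [NormedSpace ℝ P] (v : P) (g : P → ℝ) : P → ℝ :=
  fun p => fderiv ℝ g p v

section general
variable {P : Type*} [NormedAddCommGroup P] [NormedSpace ℝ P]

lemma dd_contDiffAt {m k : WithTop ℕ∞} {g : P → ℝ} {p : P} (hmk : m + 1 ≤ k)
    (hg : ContDiffAt ℝ k g p) (v : P) : ContDiffAt ℝ m (dd v g) p :=
  (hg.fderiv_right hmk).clm_apply contDiffAt_const

lemma dd_congr {g h : P → ℝ} {p : P} (v : P) (H : g =ᶠ[nhds p] h) : dd v g p = dd v h p := by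
  unfold dd; rw [H.fderiv_eq]

lemma dd_add {g h : P → ℝ} {p : P} (v : P) (hg : DifferentiableAt ℝ g p)
    (hh : DifferentiableAt ℝ h p) : dd v (fun x => g x + h x) p = dd v g p + dd v h p := by
  unfold dd; rw [fderiv_fun_add hg hh]; rfl

lemma dd_sub {g h : P → ℝ} {p : P} (v : P) (hg : DifferentiableAt ℝ g p)
    (hh : DifferentiableAt ℝ h p) : dd v (fun x => g x - h x) p = dd v g p - dd v h p := by
  unfold dd; rw [fderiv_fun_sub hg hh]; rfl

lemma dd_mul {g h : P → ℝ} {p : P} (v : P) (hg : DifferentiableAt ℝ g p)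
    (hh : DifferentiableAt ℝ h p) :
    dd v (fun x => g x * h x) p = dd v g p * h p + g p * dd v h p := by
  unfold dd; rw [fderiv_fun_mul hg hh]; simp; ring

lemma dd_const_mul {g : P → ℝ} {p : P} (v : P) (c : ℝ) (hg : DifferentiableAt ℝ g p) :
    dd v (fun x => c * g x) p = c * dd v g p := by
  unfold dd; rw [fderiv_const_mul hg]; rfl

lemma dd_sum {ι : Type*} (s : Finset ι) {g : ι → P → ℝ} {p : P} (v : P)
    (hg : ∀ i ∈ s, DifferentiableAt ℝ (g i) p) :
    dd v (fun x => ∑ i ∈ s, g i x) p = ∑ i ∈ s, dd v (g i) p := by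
  unfold dd; rw [fderiv_fun_sum hg]; simp

lemma dd_log {g : P → ℝ} {p : P} (v : P) (hg : DifferentiableAt ℝ g p) (h0 : g p ≠ 0) :
    dd v (fun x => Real.log (g x)) p = dd v g p / g p := by
  unfold dd; rw [(hg.hasFDerivAt.log h0).fderiv]; simp [div_eq_inv_mul]

lemma dd_comm {g : P → ℝ} {p : P} (v w : P) (hg : ContDiffAt ℝ 2 g p) :
    dd v (dd w g) p = dd w (dd v g) p := by
  have h1 : DifferentiableAt ℝ (fderiv ℝ g) p :=
    (hg.fderiv_right (m := 1) (by norm_num)).differentiableAt (by norm_num)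
  have key : ∀ a b : P, dd a (dd b g) p = fderiv ℝ (fderiv ℝ g) p a b := by
    intro a b
    unfold dd
    rw [fderiv_clm_apply h1 (differentiableAt_const _)]
    simp
  rw [key, key]
  exact (hg.isSymmSndFDerivAt (by simp)).eq v w

lemma dd_hasDerivAt {g : P → ℝ} {p v : P} {s : ℝ} (hg : DifferentiableAt ℝ g (p + s • v)) :
    HasDerivAt (fun s : ℝ => g (p + s • v)) (dd v g (p + s • v)) s := by
  have h : HasDerivAt (fun s : ℝ => p + s • v) v s := by
    simpa using ((hasDerivAt_id s).smul_const v).const_add p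
  exact hg.hasFDerivAt.comp_hasDerivAt s h

lemma line_tendsto (p v : P) : Filter.Tendsto (fun s : ℝ => p + s • v) (nhds 0) (nhds p) := by
  have : Continuous (fun s : ℝ => p + s • v) := by fun_prop
  simpa using this.tendsto 0

lemma second_test {g : ℝ → ℝ} (hd : DifferentiableAt ℝ g 0) (hmax : ∀ᶠ s in nhds 0, g s ≤ g 0) :
    deriv (deriv g) 0 ≤ 0 := by
  by_contra! hc
  have hm : IsLocalMax g 0 := hmax
  have h0 : deriv g 0 = 0 := hm.deriv_eq_zero
  have hmin := isLocalMin_of_deriv_deriv_pos hc h0 hd.continuousAt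
  have he : g =ᶠ[nhds 0] fun _ => g 0 := by
    filter_upwards [hm, hmin] with s h1 h2 using le_antisymm h1 h2
  have : deriv (deriv g) 0 = 0 := by
    rw [he.deriv.deriv_eq]; simp
  linarith

lemma dd_second_test {g : P → ℝ} {p v : P} (hg : ContDiffAt ℝ 2 g p)
    (hmax : ∀ᶠ s : ℝ in nhds 0, g (p + s • v) ≤ g p) :
    dd v g p = 0 ∧ dd v (dd v g) p ≤ 0 := by
  have hd : ∀ᶠ x in nhds p, DifferentiableAt ℝ g x := by
    filter_upwards [hg.eventually (by simp)] with x hx using hx.differentiableAt (by norm_num)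
  have hd' : ∀ᶠ s : ℝ in nhds 0, deriv (fun s : ℝ => g (p + s • v)) s = dd v g (p + s • v) := by
    filter_upwards [(line_tendsto p v).eventually hd] with s hs using (dd_hasDerivAt hs).deriv
  have hdd : DifferentiableAt ℝ (dd v g) (p + (0:ℝ) • v) := by
    simpa using (dd_contDiffAt (m := 1) (by norm_num) hg v).differentiableAt (by norm_num)
  have hg0 : DifferentiableAt ℝ g (p + (0:ℝ) • v) := by simpa using hd.self_of_nhds
  have hm : ∀ᶠ s : ℝ in nhds 0, g (p + s • v) ≤ g (p + (0:ℝ) • v) := by simpa using hmax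
  constructor
  · have := IsLocalMax.deriv_eq_zero (f := fun s : ℝ => g (p + s • v)) (a := 0) hm
    rw [(dd_hasDerivAt hg0).deriv] at this
    simpa using this
  · have h2 := second_test (g := fun s : ℝ => g (p + s • v)) (dd_hasDerivAt hg0).differentiableAt hm
    have h3 : deriv (fun s : ℝ => g (p + s • v)) =ᶠ[nhds 0] fun s => dd v g (p + s • v) := hd'
    rw [h3.deriv_eq, (dd_hasDerivAt hdd).deriv] at h2
    simpa using h2

lemma dd_left_test {g : P → ℝ} {p v : P} (hg : DifferentiableAt ℝ g p)
    (hmax : ∀ᶠ s : ℝ in nhdsWithin 0 (Iio 0), g (p + s • v) ≤ g p) :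
    0 ≤ dd v g p := by
  have hg0 : DifferentiableAt ℝ g (p + (0:ℝ) • v) := by simpa using hg
  have h := (dd_hasDerivAt hg0)
  have h' := hasDerivAt_iff_tendsto_slope.1 h
  have h2 := h'.mono_left (nhdsWithin_mono (0:ℝ) (s := Iio 0) (t := {0}ᶜ) (by
    intro x hx; simp at hx ⊢; exact hx.ne))
  have : dd v g p = dd v g (p + (0:ℝ) • v) := by simp
  rw [this]
  refine ge_of_tendsto h2 ?_
  filter_upwards [hmax, self_mem_nhdsWithin] with s h1 h3
  simp only [slope_def_field, zero_smul, add_zero, sub_zero]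
  exact div_nonneg_of_nonpos (by linarith) (le_of_lt h3)

end general

lemma core_alg {n : ℕ} (u Ψ q c LΨ : ℝ) (g Pi : Fin n → ℝ) (H : Fin n → Fin n → ℝ)
    (hu : 0 < u) (hΨ : 0 < Ψ) (hq0 : 0 < q) (hq : q = ∑ j, g j ^ 2)
    (h1 : ∀ i, Pi i * q + Ψ * (2 * ∑ j, g j * H i j) = Ψ * q / u * g i)
    (h2 : Ψ * (2 * ∑ i, ∑ j, H i j ^ 2) + 2 * ∑ i, Pi i * (2 * ∑ j, g j * H i j)
      + q * LΨ - c * Ψ * q ≤ 0) :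
    Ψ * q / u ≤ 4 * u * (c * Ψ - LΨ + 5 / 2 * ((∑ i, Pi i ^ 2) / Ψ)) := by
  have hCS : ∀ i, (∑ j, g j * H i j) ^ 2 ≤ q * ∑ j, H i j ^ 2 := by
    intro i; rw [hq]; exact Finset.sum_mul_sq_le_sq_mul_sq _ _ _
  have hξ : ∀ i, 2 * ∑ j, g j * H i j = q * (g i / u - Pi i / Ψ) := by
    intro i
    have := h1 i
    field_simp at this ⊢
    linarith
  have hH : ∀ i, q * (g i / u - Pi i / Ψ) ^ 2 ≤ 4 * ∑ j, H i j ^ 2 := by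
    intro i
    have := hCS i
    have h3 := hξ i
    have h4 : (∑ j, g j * H i j) = q * (g i / u - Pi i / Ψ) / 2 := by linarith
    rw [h4] at this
    have h5 : q * (q * (g i / u - Pi i / Ψ) ^ 2) ≤ q * (4 * ∑ j, H i j ^ 2) := by nlinarith
    exact le_of_mul_le_mul_left h5 hq0
  simp_rw [hξ] at h2
  have hS : Ψ * (q / 2 * ∑ i, (g i / u - Pi i / Ψ) ^ 2) ≤ Ψ * (2 * ∑ i, ∑ j, H i j ^ 2) := by
    apply mul_le_mul_of_nonneg_left _ hΨ.le
    rw [Finset.mul_sum, Finset.mul_sum]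
    apply Finset.sum_le_sum
    intro i _
    linarith [hH i]
  have hterm : ∀ i, Ψ * (q / 4 * (g i / u) ^ 2) - q * (5 / 2 * (Pi i ^ 2 / Ψ)) ≤
      Ψ * (q / 2 * (g i / u - Pi i / Ψ) ^ 2) + 2 * (Pi i * (q * (g i / u - Pi i / Ψ))) := by
    intro i
    have e : Ψ * (q / 2 * (g i / u - Pi i / Ψ) ^ 2) + 2 * (Pi i * (q * (g i / u - Pi i / Ψ)))
      - (Ψ * (q / 4 * (g i / u) ^ 2) - q * (5 / 2 * (Pi i ^ 2 / Ψ)))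
      = Ψ * q * (1 / 4 * (g i / u + 2 * (Pi i / Ψ)) ^ 2) := by
      field_simp; ring
    have : 0 ≤ Ψ * q * (1 / 4 * (g i / u + 2 * (Pi i / Ψ)) ^ 2) := by positivity
    linarith
  have hsum := Finset.sum_le_sum (s := Finset.univ) (fun i _ => hterm i)
  rw [Finset.sum_sub_distrib, Finset.sum_add_distrib, ← Finset.mul_sum, ← Finset.mul_sum,
    ← Finset.mul_sum, ← Finset.mul_sum, ← Finset.mul_sum, ← Finset.mul_sum, ← Finset.mul_sum] at hsum
  have e1 : ∑ i, (g i / u) ^ 2 = q / u ^ 2 := by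
    simp_rw [div_pow]; rw [← Finset.sum_div, hq]
  have e2 : ∑ i, Pi i ^ 2 / Ψ = (∑ i, Pi i ^ 2) / Ψ := by rw [Finset.sum_div]
  rw [e1, e2] at hsum
  have h6 : q * (Ψ * (1 / 4 * (q / u ^ 2))) ≤ q * (c * Ψ - LΨ + 5 / 2 * ((∑ i, Pi i ^ 2) / Ψ)) := by
    nlinarith
  have h7 := le_of_mul_le_mul_left h6 hq0
  have h8 : Ψ * q / u = 4 * u * (Ψ * (1 / 4 * (q / u ^ 2))) := by field_simp
  rw [h8]
  exact mul_le_mul_of_nonneg_left h7 (by positivity)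

lemma maxpoint {P : Type*} [NormedAddCommGroup P] [NormedSpace ℝ P] {n : ℕ}
    (e : Fin n → P) (et : P) (U Fp Ψ : P → ℝ) (p : P) (a κ c M : ℝ)
    (hU : ContDiffAt ℝ (⊤ : ℕ∞) U p) (hF : ContDiffAt ℝ (⊤ : ℕ∞) Fp p)
    (hΨ : ContDiffAt ℝ 2 Ψ p) (hΨ0 : 0 < Ψ p) (hU0 : 0 < U p)
    (hq0 : 0 < ∑ j, dd (e j) U p ^ 2)
    (hpde : ∀ᶠ y in nhds p, dd et U y = ∑ i, dd (e i) (dd (e i) U) y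
      - ∑ i, dd (e i) Fp y * dd (e i) U y + a * (U y * Real.log (U y)))
    (hess : -κ * ∑ j, dd (e j) U p ^ 2 ≤
      ∑ j, dd (e j) U p * ∑ i, dd (e j) (dd (e i) Fp) p * dd (e i) U p)
    (hc : 2 * κ + a * (2 + Real.log (U p)) ≤ c)
    (hM : M = Ψ p * (∑ j, dd (e j) U p ^ 2) / U p)
    (hmax : ∀ i, ∀ᶠ s : ℝ in nhds 0,
      Ψ (p + s • e i) * (∑ j, dd (e j) U (p + s • e i) ^ 2) ≤ M * U (p + s • e i))
    (hmaxt : ∀ᶠ s : ℝ in nhdsWithin 0 (Iio 0),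
      Ψ (p + s • et) * (∑ j, dd (e j) U (p + s • et) ^ 2) ≤ M * U (p + s • et)) :
    M ≤ 4 * U p * (c * Ψ p - (∑ i, dd (e i) (dd (e i) Ψ) p - ∑ i, dd (e i) Fp p * dd (e i) Ψ p
      - dd et Ψ p) + 5 / 2 * ((∑ i, dd (e i) Ψ p ^ 2) / Ψ p)) := by
  have hMU : Ψ p * (∑ j, dd (e j) U p ^ 2) = M * U p := by rw [hM]; field_simp
  -- smoothness bookkeeping
  have hUk : ∀ k : ℕ, ContDiffAt ℝ k U p := fun k => hU.of_le (by exact_mod_cast le_top)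
  have hU2 : ∀ᶠ y in nhds p, ContDiffAt ℝ 3 U y :=
    (hUk 3).eventually (by simp)
  have hΨ2 : ∀ᶠ y in nhds p, ContDiffAt ℝ 2 Ψ y := hΨ.eventually (by simp)
  have dU : ∀ᶠ y in nhds p, DifferentiableAt ℝ U y := hU2.mono fun y h => h.differentiableAt (by norm_num)
  have dU1 : ∀ᶠ y in nhds p, ∀ v, DifferentiableAt ℝ (dd v U) y := hU2.mono fun y h v =>
    (dd_contDiffAt (m := 2) (by norm_num) h v).differentiableAt (by norm_num)
  have dU2 : ∀ᶠ y in nhds p, ∀ v w, DifferentiableAt ℝ (dd w (dd v U)) y := hU2.mono fun y h v w =>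
    (dd_contDiffAt (m := 1) (by norm_num) (dd_contDiffAt (m := 2) (by norm_num) h v) w).differentiableAt
      (by norm_num)
  have dΨ : ∀ᶠ y in nhds p, DifferentiableAt ℝ Ψ y := hΨ2.mono fun y h => h.differentiableAt (by norm_num)
  have dΨ1 : ∀ᶠ y in nhds p, ∀ v, DifferentiableAt ℝ (dd v Ψ) y := hΨ2.mono fun y h v =>
    (dd_contDiffAt (m := 1) (by norm_num) h v).differentiableAt (by norm_num)
  have hFk : ∀ k : ℕ, ContDiffAt ℝ k Fp p := fun k => hF.of_le (by exact_mod_cast le_top)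
  have dF1 : ∀ v, DifferentiableAt ℝ (dd v Fp) p := fun v =>
    (dd_contDiffAt (m := 1) (k := 2) (by norm_num) (hFk 2) v).differentiableAt (by norm_num)
  -- the function q
  set q : P → ℝ := fun y => ∑ j, dd (e j) U y * dd (e j) U y with hqdef
  have hqq : ∀ y, ∑ j, dd (e j) U y ^ 2 = q y := fun y => by simp only [hqdef, sq]
  simp only [hqq] at hq0 hess hM hmax hmaxt hMU
  have q1 : ∀ᶠ y in nhds p, ∀ v, dd v q y = 2 * ∑ j, dd (e j) U y * dd v (dd (e j) U) y := by
    filter_upwards [dU1] with y h v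
    rw [hqdef, dd_sum _ _ (fun j _ => (h _).fun_mul (h _)), Finset.mul_sum]
    refine Finset.sum_congr rfl fun j _ => ?_
    rw [dd_mul _ (h _) (h _)]; ring
  have q2 : ∀ v, dd v (dd v q) p = 2 * ∑ j, (dd v (dd (e j) U) p ^ 2
      + dd (e j) U p * dd v (dd v (dd (e j) U)) p) := by
    intro v
    have d1 := dU1.self_of_nhds
    have d2 := dU2.self_of_nhds
    rw [dd_congr v (q1.mono fun y h => h v),
      dd_const_mul _ _ (DifferentiableAt.fun_sum fun j _ => (d1 _).fun_mul (d2 _ _)),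
      dd_sum _ _ (fun j _ => (d1 _).fun_mul (d2 _ _))]
    congr 1
    refine Finset.sum_congr rfl fun j _ => ?_
    rw [dd_mul _ (d1 _) (d2 _ _)]; ring
  have dq : ∀ᶠ y in nhds p, DifferentiableAt ℝ q y := by
    filter_upwards [dU1] with y h
    exact DifferentiableAt.fun_sum fun j _ => (h _).fun_mul (h _)
  have hqC : ContDiffAt ℝ 2 q p := by
    apply ContDiffAt.sum
    intro j _
    exact (dd_contDiffAt (m := 2) (by norm_num) (hUk 3) _).mul
      (dd_contDiffAt (m := 2) (by norm_num) (hUk 3) _)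
  have dq1 : ∀ v, DifferentiableAt ℝ (dd v q) p := fun v =>
    (dd_contDiffAt (m := 1) (by norm_num) hqC v).differentiableAt (by norm_num)
  -- the function F
  set F : P → ℝ := fun y => Ψ y * q y - M * U y with hFdef
  have hFC : ContDiffAt ℝ 2 F p := (hΨ.mul hqC).sub (contDiffAt_const.mul (hUk 2))
  have hFp : F p = 0 := by simp only [hFdef]; linarith
  have F1 : ∀ᶠ y in nhds p, ∀ v, dd v F y = dd v Ψ y * q y + Ψ y * dd v q y - M * dd v U y := by
    filter_upwards [dU, dΨ, dq] with y h1 h2 h3 v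
    rw [hFdef, dd_sub _ (h2.fun_mul h3) (h1.const_mul _), dd_mul _ h2 h3, dd_const_mul _ _ h1]
  have F2 : ∀ v, dd v (dd v F) p = dd v (dd v Ψ) p * q p + 2 * (dd v Ψ p * dd v q p)
      + Ψ p * dd v (dd v q) p - M * dd v (dd v U) p := by
    intro v
    have d1 := dU1.self_of_nhds v
    have d2 := dΨ1.self_of_nhds v
    have d3 := dΨ.self_of_nhds
    have d4 := dq.self_of_nhds
    have d5 := dq1 v
    rw [dd_congr v (F1.mono fun y h => h v),
      dd_sub _ ((d2.fun_mul d4).fun_add (d3.fun_mul d5)) (d1.const_mul _),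
      dd_add _ (d2.fun_mul d4) (d3.fun_mul d5), dd_mul _ d2 d4, dd_mul _ d3 d5, dd_const_mul _ _ d1]
    ring
  have T1 : ∀ i, dd (e i) F p = 0 ∧ dd (e i) (dd (e i) F) p ≤ 0 := by
    intro i
    apply dd_second_test hFC
    filter_upwards [hmax i] with s hs
    rw [hFp]; simp only [hFdef]; linarith
  have T2 : 0 ≤ dd et F p := by
    apply dd_left_test (hFC.differentiableAt (by norm_num))
    filter_upwards [hmaxt] with s hs
    rw [hFp]; simp only [hFdef]; linarith
  -- the differentiated PDE
  have pdej : ∀ j, dd et (dd (e j) U) p = ∑ i, dd (e i) (dd (e i) (dd (e j) U)) p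
      - ∑ i, (dd (e j) (dd (e i) Fp) p * dd (e i) U p + dd (e i) Fp p * dd (e i) (dd (e j) U) p)
      + a * ((Real.log (U p) + 1) * dd (e j) U p) := by
    intro j
    have d0 := dU.self_of_nhds
    have d1 := dU1.self_of_nhds
    have d2 := dU2.self_of_nhds
    have dl : DifferentiableAt ℝ (fun y => Real.log (U y)) p := d0.log hU0.ne'
    rw [dd_comm et (e j) (hUk 2), dd_congr (e j) hpde,
      dd_add _ ((DifferentiableAt.fun_sum fun i _ => d2 _ _).fun_sub
        (DifferentiableAt.fun_sum fun i _ => (dF1 _).fun_mul (d1 _))) ((d0.fun_mul dl).const_mul _),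
      dd_sub _ (DifferentiableAt.fun_sum fun i _ => d2 _ _)
        (DifferentiableAt.fun_sum fun i _ => (dF1 _).fun_mul (d1 _)),
      dd_sum _ _ (fun i _ => d2 _ _), dd_sum _ _ (fun i _ => (dF1 _).fun_mul (d1 _)),
      dd_const_mul _ _ (d0.fun_mul dl), dd_mul _ d0 dl, dd_log _ d0 hU0.ne']
    congr 1
    · congr 1
      · refine Finset.sum_congr rfl fun i _ => ?_
        rw [dd_comm (e j) (e i) (dd_contDiffAt (m := 2) (by norm_num) (hUk 3) _)]
        apply dd_congr
        filter_upwards [hU2] with y hy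
        exact dd_comm _ _ (hy.of_le (by norm_num))
      · refine Finset.sum_congr rfl fun i _ => ?_
        rw [dd_mul _ (dF1 _) (d1 _), dd_comm (e j) (e i) (hUk 2)]
    · field_simp
  have pde0 := hpde.self_of_nhds
  have q1p := q1.self_of_nhds
  have F1p := F1.self_of_nhds
  rw [hM]
  refine core_alg (U p) (Ψ p) (q p) c _ (fun j => dd (e j) U p) (fun i => dd (e i) Ψ p)
    (fun i j => dd (e i) (dd (e j) U) p) hU0 hΨ0 hq0 (hqq p).symm ?_ ?_
  · intro i
    have := (T1 i).1
    rw [F1p, q1p] at this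
    rw [← hM]; linarith
  · have S2 : ∑ i, dd (e i) (dd (e i) F) p ≤ 0 := Finset.sum_nonpos fun i _ => (T1 i).2
    have S1 : ∑ i, dd (e i) Fp p * dd (e i) F p = 0 :=
      Finset.sum_eq_zero fun i _ => by rw [(T1 i).1, mul_zero]
    have E2 : ∑ i, dd (e i) (dd (e i) F) p = (∑ i, dd (e i) (dd (e i) Ψ) p) * q p
        + 2 * ∑ i, dd (e i) Ψ p * (2 * ∑ j, dd (e j) U p * dd (e i) (dd (e j) U) p)
        + Ψ p * (2 * ∑ i, ∑ j, dd (e i) (dd (e j) U) p ^ 2)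
        + Ψ p * (2 * ∑ j, dd (e j) U p * ∑ i, dd (e i) (dd (e i) (dd (e j) U)) p)
        - M * ∑ i, dd (e i) (dd (e i) U) p := by
      have : ∑ j, dd (e j) U p * ∑ i, dd (e i) (dd (e i) (dd (e j) U)) p
          = ∑ i, ∑ j, dd (e j) U p * dd (e i) (dd (e i) (dd (e j) U)) p := by
        simp_rw [Finset.mul_sum]; rw [Finset.sum_comm]
      rw [this]
      simp_rw [F2, q2, q1p, Finset.sum_add_distrib]
      rw [Finset.sum_sub_distrib]
      simp_rw [Finset.sum_add_distrib, mul_add, Finset.sum_add_distrib, ← Finset.mul_sum,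
        ← Finset.sum_mul]
      ring
    have E1 : ∑ i, dd (e i) Fp p * dd (e i) F p = (∑ i, dd (e i) Fp p * dd (e i) Ψ p) * q p
        + Ψ p * (2 * ∑ j, dd (e j) U p * ∑ i, dd (e i) Fp p * dd (e i) (dd (e j) U) p)
        - M * ∑ i, dd (e i) Fp p * dd (e i) U p := by
      have : ∑ j, dd (e j) U p * ∑ i, dd (e i) Fp p * dd (e i) (dd (e j) U) p
          = ∑ i, dd (e i) Fp p * ∑ j, dd (e j) U p * dd (e i) (dd (e j) U) p := by
        simp_rw [Finset.mul_sum]; rw [Finset.sum_comm]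
        refine Finset.sum_congr rfl fun i _ => Finset.sum_congr rfl fun j _ => by ring
      rw [this, Finset.sum_mul, Finset.mul_sum, Finset.mul_sum, Finset.mul_sum,
        ← Finset.sum_add_distrib, ← Finset.sum_sub_distrib]
      refine Finset.sum_congr rfl fun i _ => ?_
      rw [F1p, q1p]; ring
    have E3 : dd et F p = dd et Ψ p * q p
        + Ψ p * (2 * (∑ j, dd (e j) U p * ∑ i, dd (e i) (dd (e i) (dd (e j) U)) p
          - ∑ j, dd (e j) U p * ∑ i, dd (e j) (dd (e i) Fp) p * dd (e i) U p
          - ∑ j, dd (e j) U p * ∑ i, dd (e i) Fp p * dd (e i) (dd (e j) U) p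
          + a * (Real.log (U p) + 1) * q p)) - M * dd et U p := by
      rw [F1p, q1p]
      congr 3
      congr 1
      rw [← hqq p]
      simp_rw [pdej, Finset.sum_add_distrib]
      rw [Finset.mul_sum, ← Finset.sum_sub_distrib, ← Finset.sum_sub_distrib,
        ← Finset.sum_add_distrib]
      refine Finset.sum_congr rfl fun i _ => by ring
    rw [E2] at S2
    rw [E1] at S1
    rw [E3, pde0] at T2
    have hcΨ : Ψ p * q p * (2 * κ + a * (2 + Real.log (U p))) ≤ Ψ p * q p * c :=
      mul_le_mul_of_nonneg_left hc (by positivity)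
    have hhess := mul_le_mul_of_nonneg_left hess hΨ0.le
    have hMl : M * (a * (U p * Real.log (U p))) = Ψ p * q p * a * Real.log (U p) := by
      rw [hMU]; ring
    nlinarith

lemma inner_gradient_dd {n : ℕ} (f : EuclideanSpace ℝ (Fin n) → ℝ) (x v : EuclideanSpace ℝ (Fin n)) :
    ⟪gradient f x, v⟫ = dd v f x := by
  unfold gradient dd
  rw [InnerProductSpace.toDual_symm_apply]

lemma euc_expand {n : ℕ} (y : EuclideanSpace ℝ (Fin n)) :
    y = ∑ i, y i • EuclideanSpace.single i (1:ℝ) := by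
  ext j; simp [Finset.sum_apply, Pi.single_apply]

lemma dd_expand {n : ℕ} (f : EuclideanSpace ℝ (Fin n) → ℝ) (x y : EuclideanSpace ℝ (Fin n)) :
    dd y f x = ∑ i, dd (EuclideanSpace.single i (1:ℝ)) f x * y i := by
  unfold dd
  conv_lhs => rw [euc_expand y]
  simp [mul_comm]

lemma gradient_coord {n : ℕ} (f : EuclideanSpace ℝ (Fin n) → ℝ) (x : EuclideanSpace ℝ (Fin n))
    (i : Fin n) : gradient f x i = dd (EuclideanSpace.single i (1:ℝ)) f x := by
  rw [← inner_gradient_dd, EuclideanSpace.inner_single_right]; simp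

lemma inner_gradient {n : ℕ} (f g : EuclideanSpace ℝ (Fin n) → ℝ) (x : EuclideanSpace ℝ (Fin n)) :
    ⟪gradient f x, gradient g x⟫ = ∑ i, dd (EuclideanSpace.single i (1:ℝ)) f x *
      dd (EuclideanSpace.single i (1:ℝ)) g x := by
  rw [inner_gradient_dd, dd_expand]
  simp_rw [gradient_coord]

lemma norm_gradient_sq {n : ℕ} (f : EuclideanSpace ℝ (Fin n) → ℝ) (x : EuclideanSpace ℝ (Fin n)) :
    ‖gradient f x‖ ^ 2 = ∑ i, dd (EuclideanSpace.single i (1:ℝ)) f x ^ 2 := by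
  rw [EuclideanSpace.norm_sq_eq]
  simp_rw [gradient_coord, Real.norm_eq_abs, sq_abs]

lemma drift_bound {n : ℕ} (hn : 1 ≤ n) (f : EuclideanSpace ℝ (Fin n) → ℝ)
    (x₀ : EuclideanSpace ℝ (Fin n)) (R K : ℝ) (hf : ContDiff ℝ (⊤ : ℕ∞) f) (hK : 0 ≤ K)
    (hess : ∀ x ∈ ball x₀ R, ∀ v : EuclideanSpace ℝ (Fin n),
          hessQF f x v ≥ -((n : ℝ) - 1) * K * ‖v‖ ^ 2)
    (x : EuclideanSpace ℝ (Fin n)) (hx : x ∈ ball x₀ R) (h1 : 1 ≤ ‖x - x₀‖) :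
    - dd (x - x₀) f x ≤ R * (|alphaC f x₀| + n * K * R) := by
  set r := ‖x - x₀‖ with hr
  have hrR : r < R := by rw [hr, ← mem_ball_iff_norm]; exact hx
  set θ := r⁻¹ • (x - x₀) with hθ
  have hr0 : 0 < r := by linarith
  have hθ1 : ‖θ‖ = 1 := by
    rw [hθ, norm_smul, norm_inv, Real.norm_eq_abs, abs_of_pos hr0, ← hr]; field_simp
  have hxθ : x - x₀ = r • θ := by rw [hθ, smul_smul]; field_simp; simp
  have hn1 : (1:ℝ) ≤ n := by exact_mod_cast hn
  have hdfk : ∀ (k : ℕ) y, ContDiffAt ℝ k f y := fun k y =>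
    (hf.contDiffAt).of_le (by exact_mod_cast le_top)
  have hdf := hdfk 2
  have hd1 : ∀ y v, DifferentiableAt ℝ (dd v f) y := fun y v =>
    (dd_contDiffAt (m := 1) (k := 2) (by norm_num) (hdf y) v).differentiableAt (by norm_num)
  -- sphere value
  have hs : -dd θ f (x₀ + θ) ≤ |alphaC f x₀| := by
    have hb : BddAbove ((fun y => (n : ℝ) - 1 - ⟪gradient f y, y - x₀⟫) '' sphere x₀ 1) := by
      apply IsCompact.bddAbove
      apply (isCompact_sphere x₀ 1).image
      have hc : Continuous (fun y => (n : ℝ) - 1 - fderiv ℝ f y (y - x₀)) := by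
        have : Continuous (fderiv ℝ f) := hf.continuous_fderiv (by simp)
        fun_prop
      simp_rw [inner_gradient_dd]
      exact hc
    have hmem : (n : ℝ) - 1 - ⟪gradient f (x₀ + θ), (x₀ + θ) - x₀⟫ ≤ alphaC f x₀ :=
      le_csSup hb ⟨x₀ + θ, by simp [hθ1], rfl⟩
    rw [inner_gradient_dd, add_sub_cancel_left] at hmem
    have := le_abs_self (alphaC f x₀)
    linarith
  have hmvt := (convex_Icc (1:ℝ) r).mul_sub_le_image_sub_of_le_deriv
    (f := fun s => dd θ f (x₀ + s • θ)) (C := -((n:ℝ) - 1) * K)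
    (fun s _ => (dd_hasDerivAt (hd1 _ _)).continuousAt.continuousWithinAt)
    (fun s _ => (dd_hasDerivAt (hd1 _ _)).differentiableAt.differentiableWithinAt)
    (fun s hs => by
      rw [interior_Icc] at hs
      rw [(dd_hasDerivAt (hd1 _ _)).deriv]
      have := hess (x₀ + s • θ) (by
        rw [mem_ball_iff_norm, add_sub_cancel_left, norm_smul, hθ1, Real.norm_eq_abs,
          abs_of_pos (by linarith [hs.1])]; linarith [hs.2]) θ
      rw [hθ1] at this
      have e : hessQF f (x₀ + s • θ) θ = dd θ (dd θ f) (x₀ + s • θ) := rfl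
      rw [e] at this
      linarith)
    1 ⟨le_rfl, h1⟩ r ⟨h1, le_rfl⟩ h1
  simp only [one_smul] at hmvt
  rw [← hxθ, add_sub_cancel] at hmvt
  have h3 : dd (x - x₀) f x = r * dd θ f x := by
    rw [hxθ]; unfold dd; simp
  rw [h3]
  have h4 : -dd θ f x ≤ |alphaC f x₀| + n * K * R := by
    have h5 : ((n:ℝ) - 1) * K * (r - 1) ≤ n * K * R := by
      gcongr <;> linarith
    linarith
  have h6 : 0 ≤ |alphaC f x₀| + n * K * R := by
    have : 0 ≤ n * K * R := by have : 0 ≤ R := by linarith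
                               positivity
    positivity
  nlinarith

/-- positive part powers -/
lemma hasDerivAt_mp (k : ℕ) (s : ℝ) :
    HasDerivAt (fun s : ℝ => max s 0 ^ (k + 2)) ((k + 2 : ℝ) * max s 0 ^ (k + 1)) s := by
  rcases lt_trichotomy s 0 with h | h | h
  · have : (fun s : ℝ => max s 0 ^ (k + 2)) =ᶠ[nhds s] fun _ => 0 := by
      filter_upwards [Iio_mem_nhds h] with y hy
      rw [max_eq_right (le_of_lt hy)]; simp
    rw [max_eq_right h.le]
    simpa using (hasDerivAt_const s (0:ℝ)).congr_of_eventuallyEq this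
  · subst h
    simp only [max_self]
    rw [hasDerivAt_iff_isLittleO_nhds_zero]
    simp
    have h1 : (fun h : ℝ => max h 0 ^ (k + 2)) =O[nhds 0] fun h : ℝ => h ^ (k + 2) := by
      apply Asymptotics.IsBigO.of_bound 1
      filter_upwards with y
      rw [one_mul, norm_pow, norm_pow]
      gcongr
      rw [Real.norm_eq_abs, Real.norm_eq_abs, abs_of_nonneg (le_max_right _ _)]
      exact max_le (le_abs_self _) (abs_nonneg _)
    refine h1.trans_isLittleO ?_
    simpa using Asymptotics.isLittleO_pow_pow (𝕜 := ℝ) (m := 1) (n := k + 2) (by omega)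
  · have : (fun s : ℝ => max s 0 ^ (k + 2)) =ᶠ[nhds s] fun s => s ^ (k + 2) := by
      filter_upwards [Ioi_mem_nhds h] with y hy
      rw [max_eq_left (le_of_lt hy)]
    rw [max_eq_left h.le]
    have h2 := (hasDerivAt_pow (k + 2) s).congr_of_eventuallyEq this
    exact h2.congr_deriv (by push_cast; simp)

def kk (s : ℝ) : ℝ := (1 - 8 * max s 0 ^ 3) ^ 2
def kk1 (s : ℝ) : ℝ := -48 * max s 0 ^ 2 * (1 - 8 * max s 0 ^ 3)
def kk2 (s : ℝ) : ℝ := -96 * max s 0 * (1 - 8 * max s 0 ^ 3) + 1152 * max s 0 ^ 4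

lemma kk_deriv (s : ℝ) : HasDerivAt kk (kk1 s) s := by
  have h := (((hasDerivAt_mp 1 s).const_mul 8).const_sub 1).pow 2
  exact h.congr_deriv (by simp only [kk1]; push_cast; norm_num; ring)

lemma kk1_deriv (s : ℝ) : HasDerivAt kk1 (kk2 s) s := by
  have h := ((hasDerivAt_mp 0 s).const_mul (-48)).mul (((hasDerivAt_mp 1 s).const_mul 8).const_sub 1)
  exact h.congr_deriv (by simp only [kk2]; norm_num; ring)

lemma kk_contDiff : ContDiff ℝ 2 kk := by
  have e1 : deriv kk = kk1 := funext fun s => (kk_deriv s).deriv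
  have e2 : deriv kk1 = kk2 := funext fun s => (kk1_deriv s).deriv
  have h1 : ContDiff ℝ 1 kk1 := by
    rw [contDiff_one_iff_deriv, e2]
    refine ⟨fun s => (kk1_deriv s).differentiableAt, ?_⟩
    unfold kk2; fun_prop
  have : ContDiff ℝ (1 + 1) kk := by
    rw [contDiff_succ_iff_deriv, e1]
    exact ⟨fun s => (kk_deriv s).differentiableAt, by simp, h1⟩
  exact this.of_le (by norm_num)

def ss {n : ℕ} (x₀ : EuclideanSpace ℝ (Fin n)) (R : ℝ) (x : EuclideanSpace ℝ (Fin n)) : ℝ :=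
  ‖x - x₀‖ ^ 2 / R ^ 2 - 1 / 4

def phi {n : ℕ} (x₀ : EuclideanSpace ℝ (Fin n)) (R : ℝ) (x : EuclideanSpace ℝ (Fin n)) : ℝ :=
  kk (ss x₀ R x)

lemma ss_contDiff {n : ℕ} (x₀ : EuclideanSpace ℝ (Fin n)) (R : ℝ) : ContDiff ℝ 2 (ss x₀ R) := by
  unfold ss
  exact (((contDiff_id.sub contDiff_const).norm_sq ℝ).div_const _).sub contDiff_const

lemma phi_contDiff {n : ℕ} (x₀ : EuclideanSpace ℝ (Fin n)) (R : ℝ) : ContDiff ℝ 2 (phi x₀ R) :=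
  kk_contDiff.comp (ss_contDiff x₀ R)

lemma dd_comp {P : Type*} [NormedAddCommGroup P] [NormedSpace ℝ P] {k : ℝ → ℝ} {k' : ℝ}
    {g : P → ℝ} {p : P} (v : P) (hk : HasDerivAt k k' (g p)) (hg : DifferentiableAt ℝ g p) :
    dd v (fun y => k (g y)) p = k' * dd v g p := by
  unfold dd
  have := hk.comp_hasFDerivAt p hg.hasFDerivAt
  rw [show (fun y => k (g y)) = k ∘ g from rfl, this.fderiv]; simp

lemma dd_ss {n : ℕ} (x₀ : EuclideanSpace ℝ (Fin n)) (R : ℝ) (x : EuclideanSpace ℝ (Fin n)) (i : Fin n) :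
    dd (EuclideanSpace.single i (1:ℝ)) (ss x₀ R) x = 2 / R ^ 2 * (x - x₀) i := by
  have h := ((((hasFDerivAt_id x).sub_const x₀).norm_sq).mul_const ((R^2)⁻¹)).sub_const (1/4)
  unfold dd
  have h2 : HasFDerivAt (ss x₀ R) _ x := h
  rw [h2.fderiv]
  simp [EuclideanSpace.inner_single_right]; ring

lemma dd_coord {n : ℕ} (x₀ : EuclideanSpace ℝ (Fin n)) (x : EuclideanSpace ℝ (Fin n)) (i : Fin n) :
    DifferentiableAt ℝ (fun y : EuclideanSpace ℝ (Fin n) => (y - x₀) i) x ∧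
    dd (EuclideanSpace.single i (1:ℝ)) (fun y => (y - x₀) i) x = 1 := by
  have h : HasFDerivAt (fun y : EuclideanSpace ℝ (Fin n) => (y - x₀) i)
      (EuclideanSpace.proj i : EuclideanSpace ℝ (Fin n) →L[ℝ] ℝ) x := by
    have := (EuclideanSpace.proj i : EuclideanSpace ℝ (Fin n) →L[ℝ] ℝ).hasFDerivAt (x := x)
    simpa using this.sub_const (x₀ i)
  refine ⟨h.differentiableAt, ?_⟩
  unfold dd; rw [h.fderiv]; simp

lemma dd_phi {n : ℕ} (x₀ : EuclideanSpace ℝ (Fin n)) (R : ℝ) (x : EuclideanSpace ℝ (Fin n)) (i : Fin n) :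
    dd (EuclideanSpace.single i (1:ℝ)) (phi x₀ R) x = kk1 (ss x₀ R x) * (2 / R ^ 2 * (x - x₀) i) := by
  have := dd_comp (EuclideanSpace.single i (1:ℝ)) (kk_deriv (ss x₀ R x))
    ((ss_contDiff x₀ R).differentiable (by norm_num) x)
  rw [dd_ss] at this
  exact this

lemma dd_dd_phi {n : ℕ} (x₀ : EuclideanSpace ℝ (Fin n)) (R : ℝ) (x : EuclideanSpace ℝ (Fin n)) (i : Fin n) :
    dd (EuclideanSpace.single i (1:ℝ)) (dd (EuclideanSpace.single i (1:ℝ)) (phi x₀ R)) x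
      = kk2 (ss x₀ R x) * (2 / R ^ 2 * (x - x₀) i) ^ 2 + kk1 (ss x₀ R x) * (2 / R ^ 2) := by
  have e : dd (EuclideanSpace.single i (1:ℝ)) (phi x₀ R) =
    fun x => kk1 (ss x₀ R x) * (2 / R ^ 2 * (x - x₀) i) := funext fun x => dd_phi x₀ R x i
  have ds := (ss_contDiff x₀ R).differentiable (by norm_num) x
  have d1 : DifferentiableAt ℝ (fun x => kk1 (ss x₀ R x)) x :=
    (kk1_deriv _).differentiableAt.comp x ds
  rw [e, dd_mul _ d1 ((dd_coord x₀ x i).1.const_mul _), dd_comp _ (kk1_deriv _) ds, dd_ss,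
    dd_const_mul _ _ (dd_coord x₀ x i).1, (dd_coord x₀ x i).2]
  ring

lemma kk_facts {s : ℝ} (hs : s ≤ 1 / 2) :
    0 ≤ kk s ∧ kk s ≤ 1 ∧ kk1 s ≤ 0 ∧ -12 ≤ kk1 s ∧ -48 ≤ kk2 s ∧ kk1 s ^ 2 ≤ 144 * kk s := by
  have h0 : 0 ≤ max s 0 := le_max_right _ _
  have h1 : max s 0 ≤ 1 / 2 := max_le hs (by norm_num)
  unfold kk kk1 kk2
  set m := max s 0
  have h3 : m ^ 3 ≤ 1 / 8 := by
    calc m ^ 3 ≤ (1/2) ^ 3 := by gcongr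
      _ = 1 / 8 := by norm_num
  have h2 : m ^ 2 ≤ 1 / 4 := by
    calc m ^ 2 ≤ (1/2) ^ 2 := by gcongr
      _ = 1 / 4 := by norm_num
  have h30 : 0 ≤ m ^ 3 := by positivity
  have h20 : 0 ≤ m ^ 2 := by positivity
  have h40 : 0 ≤ m ^ 4 := by positivity
  set b := 1 - 8 * m ^ 3 with hb
  have hb0 : 0 ≤ b := by linarith
  have hb1 : b ≤ 1 := by linarith
  refine ⟨by positivity, by nlinarith, by nlinarith [mul_nonneg h20 hb0], ?_, ?_, ?_⟩
  · have : m ^ 2 * b ≤ 1 / 4 * 1 := by gcongr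
    nlinarith
  · have : m * b ≤ 1 / 2 * 1 := by gcongr
    nlinarith
  · have : (m ^ 2) ^ 2 ≤ (1/4) ^ 2 := by gcongr
    have : (m ^ 2) ^ 2 * b ^ 2 ≤ (1/4) ^ 2 * b ^ 2 := by gcongr
    nlinarith

lemma phi_bounds {n : ℕ} (hn : 1 ≤ n) (f : EuclideanSpace ℝ (Fin n) → ℝ)
    (x₀ : EuclideanSpace ℝ (Fin n)) (R K : ℝ) (hf : ContDiff ℝ (⊤ : ℕ∞) f) (hR : 2 ≤ R) (hK : 0 ≤ K)
    (hess : ∀ x ∈ ball x₀ R, ∀ v : EuclideanSpace ℝ (Fin n),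
          hessQF f x v ≥ -((n : ℝ) - 1) * K * ‖v‖ ^ 2)
    (x : EuclideanSpace ℝ (Fin n)) (hx : x ∈ ball x₀ R) (hs : ss x₀ R x ≤ 1 / 2) :
    - ∑ i, dd (EuclideanSpace.single i (1:ℝ)) (dd (EuclideanSpace.single i (1:ℝ)) (phi x₀ R)) x
      ≤ (192 + 24 * n) / R ^ 2 ∧
    ∑ i, dd (EuclideanSpace.single i (1:ℝ)) (phi x₀ R) x ^ 2 ≤ 576 / R ^ 2 * phi x₀ R x ∧
    ∑ i, dd (EuclideanSpace.single i (1:ℝ)) f x * dd (EuclideanSpace.single i (1:ℝ)) (phi x₀ R) x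
      ≤ 24 * (|alphaC f x₀| / R) + 24 * n * K := by
  obtain ⟨k0, k1, k10, k11, k2, k12⟩ := kk_facts hs
  have hR0 : 0 < R := by linarith
  have hy : ‖x - x₀‖ < R := by rw [← mem_ball_iff_norm]; exact hx
  have hy2 : ‖x - x₀‖ ^ 2 ≤ R ^ 2 := by gcongr
  have hyn : ∑ i, (x - x₀) i ^ 2 = ‖x - x₀‖ ^ 2 := by
    rw [EuclideanSpace.norm_sq_eq]; simp_rw [Real.norm_eq_abs, sq_abs]
  have hRR : ‖x - x₀‖ ^ 2 / R ^ 4 ≤ 1 / R ^ 2 := by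
    rw [div_le_div_iff₀ (by positivity) (by positivity)]; nlinarith [sq_nonneg R]
  have hRR0 : 0 ≤ ‖x - x₀‖ ^ 2 / R ^ 4 := by positivity
  have hi0 : 0 < 1 / R ^ 2 := by positivity
  refine ⟨?_, ?_, ?_⟩
  · simp_rw [dd_dd_phi, mul_pow]
    rw [Finset.sum_add_distrib, ← Finset.mul_sum, ← Finset.mul_sum, hyn]
    simp only [Finset.sum_const, Finset.card_univ, Fintype.card_fin, nsmul_eq_mul]
    have e1 : kk2 (ss x₀ R x) * ((2 / R ^ 2) ^ 2 * ‖x - x₀‖ ^ 2)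
      = 4 * (kk2 (ss x₀ R x) * (‖x - x₀‖ ^ 2 / R ^ 4)) := by field_simp; ring
    have e2 : (n:ℝ) * (kk1 (ss x₀ R x) * (2 / R ^ 2)) = 2 * n * (kk1 (ss x₀ R x) * (1 / R ^ 2)) := by
      ring
    have e3 : (192 + 24 * (n:ℝ)) / R ^ 2 = 192 * (1 / R ^ 2) + 2 * n * (12 * (1 / R ^ 2)) := by ring
    rw [e1, e2, e3]
    have a1 : -48 * (‖x - x₀‖ ^ 2 / R ^ 4) ≤ kk2 (ss x₀ R x) * (‖x - x₀‖ ^ 2 / R ^ 4) := by gcongr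
    have a2 : -12 * (1 / R ^ 2) ≤ kk1 (ss x₀ R x) * (1 / R ^ 2) := by gcongr
    have a3 : 2 * (n:ℝ) * (-12 * (1 / R ^ 2)) ≤ 2 * n * (kk1 (ss x₀ R x) * (1 / R ^ 2)) := by gcongr
    linarith
  · simp_rw [dd_phi, mul_pow]
    rw [← Finset.mul_sum, ← Finset.mul_sum, hyn]
    have e1 : kk1 (ss x₀ R x) ^ 2 * ((2 / R ^ 2) ^ 2 * ‖x - x₀‖ ^ 2)
      = 4 * (kk1 (ss x₀ R x) ^ 2 * (‖x - x₀‖ ^ 2 / R ^ 4)) := by field_simp; ring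
    rw [e1]
    have a1 : kk1 (ss x₀ R x) ^ 2 * (‖x - x₀‖ ^ 2 / R ^ 4) ≤ (144 * kk (ss x₀ R x)) * (1 / R ^ 2) := by
      gcongr
    have e2 : 576 / R ^ 2 * phi x₀ R x = 4 * ((144 * kk (ss x₀ R x)) * (1 / R ^ 2)) := by
      unfold phi; ring
    linarith
  · have e1 : ∑ i, dd (EuclideanSpace.single i (1:ℝ)) f x * dd (EuclideanSpace.single i (1:ℝ)) (phi x₀ R) x
      = (-kk1 (ss x₀ R x)) * (2 / R ^ 2) * (-dd (x - x₀) f x) := by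
      rw [dd_expand f x (x - x₀), neg_mul, neg_mul_neg, Finset.mul_sum]
      refine Finset.sum_congr rfl fun i _ => ?_
      rw [dd_phi]; ring
    rw [e1]
    have hpos : 0 ≤ 24 * (|alphaC f x₀| / R) + 24 * n * K := by positivity
    by_cases h1 : 1 ≤ ‖x - x₀‖
    · have := drift_bound hn f x₀ R K hf hK hess x hx h1
      have hp2 : 0 ≤ R * (|alphaC f x₀| + n * K * R) := by positivity
      calc (-kk1 (ss x₀ R x)) * (2 / R ^ 2) * (-dd (x - x₀) f x)
          ≤ (-kk1 (ss x₀ R x)) * (2 / R ^ 2) * (R * (|alphaC f x₀| + n * K * R)) := by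
            apply mul_le_mul_of_nonneg_left this
            exact mul_nonneg (by linarith) (by positivity)
        _ ≤ 12 * (2 / R ^ 2) * (R * (|alphaC f x₀| + n * K * R)) := by
            gcongr; linarith
        _ = 24 * (|alphaC f x₀| / R) + 24 * n * K := by field_simp; ring
    · have hss : ss x₀ R x ≤ 0 := by
        unfold ss
        push Not at h1
        have : ‖x - x₀‖ ^ 2 ≤ 1 ^ 2 := by gcongr
        have h4 : ‖x - x₀‖ ^ 2 / R ^ 2 ≤ 1 / 4 := by
          rw [div_le_div_iff₀ (by positivity) (by norm_num)]; nlinarith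
        linarith
      have : kk1 (ss x₀ R x) = 0 := by unfold kk1; rw [max_eq_right hss]; simp
      rw [this]; simpa using hpos

lemma dd_fst {n : ℕ} {g : EuclideanSpace ℝ (Fin n) → ℝ} (v : EuclideanSpace ℝ (Fin n))
    (p : EuclideanSpace ℝ (Fin n) × ℝ) (w : ℝ) (hg : DifferentiableAt ℝ g p.1) :
    dd (v, w) (fun p : EuclideanSpace ℝ (Fin n) × ℝ => g p.1) p = dd v g p.1 := by
  unfold dd
  have := hg.hasFDerivAt.comp p (hasFDerivAt_fst (p := p))
  have h2 : HasFDerivAt (fun p : EuclideanSpace ℝ (Fin n) × ℝ => g p.1) _ p := this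
  rw [h2.fderiv]; simp

lemma dd_snd {n : ℕ} (v : EuclideanSpace ℝ (Fin n)) (s₀ : ℝ)
    (p : EuclideanSpace ℝ (Fin n) × ℝ) (w : ℝ) :
    dd (v, w) (fun p : EuclideanSpace ℝ (Fin n) × ℝ => p.2 - s₀) p = w := by
  unfold dd
  have h2 : HasFDerivAt (fun p : EuclideanSpace ℝ (Fin n) × ℝ => p.2 - s₀) _ p :=
    (hasFDerivAt_snd (𝕜 := ℝ) (p := p)).sub_const s₀
  rw [h2.fderiv]; simp

lemma slice_x {n : ℕ} {U : EuclideanSpace ℝ (Fin n) × ℝ → ℝ} {x : EuclideanSpace ℝ (Fin n)} {t : ℝ}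
    (v : EuclideanSpace ℝ (Fin n)) (h : DifferentiableAt ℝ U (x, t)) :
    dd v (fun y => U (y, t)) x = dd (v, 0) U (x, t) := by
  unfold dd
  have := h.hasFDerivAt.comp x (hasFDerivAt_prodMk_left (𝕜 := ℝ) x t)
  have h2 : HasFDerivAt (fun y => U (y, t)) _ x := this
  rw [h2.fderiv]; simp

lemma slice_t {n : ℕ} {U : EuclideanSpace ℝ (Fin n) × ℝ → ℝ} {x : EuclideanSpace ℝ (Fin n)} {t : ℝ}
    (h : DifferentiableAt ℝ U (x, t)) :
    deriv (fun s => U (x, s)) t = dd (0, 1) U (x, t) := by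
  unfold dd
  have := h.hasFDerivAt.comp t (hasFDerivAt_prodMk_right x t)
  have h2 : HasFDerivAt (fun s => U (x, s)) _ t := this
  rw [h2.hasDerivAt.deriv]; simp

lemma hess_expand {n : ℕ} {f : EuclideanSpace ℝ (Fin n) → ℝ} (hf : ContDiff ℝ 2 f)
    (x v : EuclideanSpace ℝ (Fin n)) :
    hessQF f x v = ∑ j, v j * ∑ i, dd (EuclideanSpace.single j (1:ℝ))
      (dd (EuclideanSpace.single i (1:ℝ)) f) x * v i := by
  have hd : ∀ w, DifferentiableAt ℝ (dd w f) x := fun w =>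
    (dd_contDiffAt (m := 1) (k := 2) (by norm_num) hf.contDiffAt w).differentiableAt (by norm_num)
  have e : hessQF f x v = dd v (dd v f) x := rfl
  rw [e, dd_expand]
  refine Finset.sum_congr rfl fun j _ => ?_
  rw [mul_comm]
  congr 1
  have : dd v f = fun y => ∑ i, v i * dd (EuclideanSpace.single i (1:ℝ)) f y := by
    funext y; rw [dd_expand]; exact Finset.sum_congr rfl fun i _ => mul_comm _ _
  rw [this, dd_sum _ _ (fun i _ => (hd _).const_mul _)]
  refine Finset.sum_congr rfl fun i _ => ?_
  rw [dd_const_mul _ _ (hd _), mul_comm]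

lemma phi_one {n : ℕ} (x₀ : EuclideanSpace ℝ (Fin n)) (R : ℝ) (hR : 0 < R)
    (x : EuclideanSpace ℝ (Fin n)) (hx : x ∈ ball x₀ (R / 2)) :
    ss x₀ R x ≤ 0 ∧ phi x₀ R x = 1 := by
  have hy : ‖x - x₀‖ < R / 2 := by rw [← mem_ball_iff_norm]; exact hx
  have hs : ss x₀ R x ≤ 0 := by
    unfold ss
    have : ‖x - x₀‖ ^ 2 ≤ (R / 2) ^ 2 := by gcongr
    have h4 : ‖x - x₀‖ ^ 2 / R ^ 2 ≤ 1 / 4 := by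
      rw [div_le_div_iff₀ (by positivity) (by norm_num)]; nlinarith
    linarith
  refine ⟨hs, ?_⟩
  unfold phi kk; rw [max_eq_right hs]; norm_num

set_option maxHeartbeats 2000000 in
lemma interior_est {n : ℕ} (hn : 1 ≤ n) (f : EuclideanSpace ℝ (Fin n) → ℝ)
    (x₀ : EuclideanSpace ℝ (Fin n)) (R K t₀ T a D : ℝ) (U : EuclideanSpace ℝ (Fin n) × ℝ → ℝ)
    (hf : ContDiff ℝ (⊤ : ℕ∞) f) (hR : 2 ≤ R) (hK : 0 ≤ K) (ha : 0 ≤ a) (hD : 0 < D)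
    (hess : ∀ x ∈ ball x₀ R, ∀ v : EuclideanSpace ℝ (Fin n),
          hessQF f x v ≥ -((n : ℝ) - 1) * K * ‖v‖ ^ 2)
    (hU : ∀ x ∈ ball x₀ R, ∀ t ∈ Ioo (t₀ - T) t₀, ContDiffAt ℝ (⊤ : ℕ∞) U (x, t))
    (hpos : ∀ x ∈ ball x₀ R, ∀ t ∈ Ioo (t₀ - T) t₀, 0 < U (x, t) ∧ U (x, t) ≤ D)
    (hpde : ∀ x ∈ ball x₀ R, ∀ t ∈ Ioo (t₀ - T) t₀,
      dd ((0 : EuclideanSpace ℝ (Fin n)), (1:ℝ)) U (x, t)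
        = ∑ i, dd (EuclideanSpace.single i (1:ℝ), (0:ℝ))
            (dd (EuclideanSpace.single i (1:ℝ), (0:ℝ)) U) (x, t)
          - ∑ i, dd (EuclideanSpace.single i (1:ℝ)) f x
            * dd (EuclideanSpace.single i (1:ℝ), (0:ℝ)) U (x, t)
          + a * (U (x, t) * Real.log (U (x, t))))
    (x : EuclideanSpace ℝ (Fin n)) (hx : x ∈ ball x₀ (R / 2)) (t : ℝ) (ht : t ∈ Ioo (t₀ - T) t₀) :
    ∑ i, dd (EuclideanSpace.single i (1:ℝ), (0:ℝ)) U (x, t) ^ 2 ≤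
      (4 * (1632 + 24 * n)) * D * U (x, t) *
        (1 / R ^ 2 + |alphaC f x₀| / R + 1 / (t - t₀ + T) + K
          + max (2 * ((n : ℝ) - 1) * K + a * (2 + Real.log D)) 0) := by
  set c₁ := max (2 * ((n : ℝ) - 1) * K + a * (2 + Real.log D)) 0 with hc₁
  have hc₁0 : 0 ≤ c₁ := le_max_right _ _
  have hR0 : 0 < R := by linarith
  have hn1 : (1:ℝ) ≤ n := by exact_mod_cast hn
  set s₀ := (t + (t₀ - T)) / 2 with hs₀
  have hs₀t : s₀ < t := by linarith [ht.1]
  have hs₀T : t₀ - T < s₀ := by linarith [ht.1]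
  let e : Fin n → EuclideanSpace ℝ (Fin n) × ℝ := fun i => (EuclideanSpace.single i (1:ℝ), (0:ℝ))
  let et : EuclideanSpace ℝ (Fin n) × ℝ := (0, 1)
  let Ψ : EuclideanSpace ℝ (Fin n) × ℝ → ℝ := fun p => (p.2 - s₀) * phi x₀ R p.1
  let Fp : EuclideanSpace ℝ (Fin n) × ℝ → ℝ := fun p => f p.1
  let q : EuclideanSpace ℝ (Fin n) × ℝ → ℝ := fun p => ∑ j, dd (e j) U p ^ 2
  let A : Set (EuclideanSpace ℝ (Fin n)) := {y | ss x₀ R y ≤ 1 / 2}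
  have hss : Continuous (ss x₀ R) := (ss_contDiff x₀ R).continuous
  have hA : A ⊆ ball x₀ R := by
    intro y hy
    have h1 : ‖y - x₀‖ ^ 2 / R ^ 2 - 1 / 4 ≤ 1 / 2 := hy
    have h2 : ‖y - x₀‖ ^ 2 ≤ 3 / 4 * R ^ 2 := by
      rw [← div_le_iff₀ (by positivity)]; linarith
    rw [mem_ball_iff_norm]
    nlinarith [norm_nonneg (y - x₀)]
  have hAc : IsCompact A := IsCompact.of_isClosed_subset (isCompact_closedBall x₀ R)
    (isClosed_le hss continuous_const) (hA.trans ball_subset_closedBall)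
  let C : Set (EuclideanSpace ℝ (Fin n) × ℝ) := A ×ˢ Icc s₀ t
  have hC : IsCompact C := hAc.prod isCompact_Icc
  have hIcc : ∀ s ∈ Icc s₀ t, s ∈ Ioo (t₀ - T) t₀ := fun s hs =>
    ⟨by linarith [hs.1], by linarith [hs.2, ht.2]⟩
  have hUC : ∀ p ∈ C, ContDiffAt ℝ (⊤ : ℕ∞) U p := fun p hp => hU p.1 (hA hp.1) p.2 (hIcc _ hp.2)
  have hposC : ∀ p ∈ C, 0 < U p ∧ U p ≤ D := fun p hp => hpos p.1 (hA hp.1) p.2 (hIcc _ hp.2)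
  have hΨC : ContDiff ℝ 2 Ψ := (contDiff_snd.sub contDiff_const).mul ((phi_contDiff x₀ R).comp contDiff_fst)
  have hG : ContinuousOn (fun p => Ψ p * q p / U p) C := by
    intro p hp
    apply ContinuousAt.continuousWithinAt
    have hUk : ∀ k : ℕ, ContDiffAt ℝ k U p := fun k => (hUC p hp).of_le (by exact_mod_cast le_top)
    have hq : ContinuousAt q p := by
      apply tendsto_finsetSum
      intro j _
      exact ((dd_contDiffAt (m := 1) (k := 2) (by norm_num) (hUk 2) (e j)).continuousAt).pow 2
    exact (hΨC.continuous.continuousAt.mul hq).div (hUC p hp).continuousAt (hposC p hp).1.ne'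
  obtain ⟨hsx, hphix⟩ := phi_one x₀ R hR0 x hx
  have hxC : (x, t) ∈ C := ⟨by show ss x₀ R x ≤ 1 / 2; linarith, ⟨hs₀t.le, le_rfl⟩⟩
  obtain ⟨p, hpC, hpmax⟩ := hC.exists_isMaxOn ⟨_, hxC⟩ hG
  set M := Ψ p * q p / U p with hM
  have hmaxC : ∀ y ∈ C, Ψ y * q y ≤ M * U y := by
    intro y hy
    have : Ψ y * q y / U y ≤ M := hpmax hy
    rwa [div_le_iff₀ (hposC y hy).1] at this
  obtain ⟨hUp, hUpD⟩ := hposC p hpC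
  have hxt := hmaxC _ hxC
  have hΨxt : Ψ (x, t) = t - s₀ := by simp only [Ψ, hphix, mul_one]
  rw [hΨxt] at hxt
  have hUxt := (hposC _ hxC).1
  set S := 1 / R ^ 2 + |alphaC f x₀| / R + 1 / (t - t₀ + T) + K + c₁ with hS
  have htT : 0 < t - t₀ + T := by linarith [ht.1]
  have hS0 : 0 ≤ S := by positivity
  have hqn : ∀ y, 0 ≤ q y := fun y => Finset.sum_nonneg fun j _ => sq_nonneg _
  set B := c₁ + (1632 + 24 * n) / R ^ 2 + 24 * (|alphaC f x₀| / R) + 24 * n * K with hB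
  have hB0 : 0 ≤ B := by positivity
  -- main bound on M
  have hMb : M ≤ 4 * D * (1 + (t - s₀) * B) := by
    by_cases hM0 : M ≤ 0
    · refine hM0.trans ?_
      have : 0 ≤ t - s₀ := by linarith
      positivity
    push Not at hM0
    obtain ⟨kf0, kf1, -⟩ := kk_facts hpC.1
    have hφ0 : 0 ≤ phi x₀ R p.1 := kf0
    have hφ1 : phi x₀ R p.1 ≤ 1 := kf1
    have hτ0 : 0 ≤ p.2 - s₀ := by linarith [hpC.2.1]
    have hτt : p.2 - s₀ ≤ t - s₀ := by linarith [hpC.2.2]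
    have hΨq : 0 < Ψ p * q p := by
      have := hM0
      rw [hM, div_pos_iff_of_pos_right hUp] at this
      exact this
    have hΨn : 0 ≤ Ψ p := mul_nonneg hτ0 hφ0
    have hΨp : 0 < Ψ p := lt_of_le_of_ne hΨn (fun h => by rw [← h] at hΨq; simp at hΨq)
    have hqp : 0 < q p := lt_of_le_of_ne (hqn p) (fun h => by rw [← h] at hΨq; simp at hΨq)
    have hτp : 0 < p.2 - s₀ := lt_of_le_of_ne hτ0 (fun h => by
      have : Ψ p = (p.2 - s₀) * phi x₀ R p.1 := rfl
      rw [← h, zero_mul] at this; linarith)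
    have hφp : 0 < phi x₀ R p.1 := lt_of_le_of_ne hφ0 (fun h => by
      have : Ψ p = (p.2 - s₀) * phi x₀ R p.1 := rfl
      rw [← h, mul_zero] at this; linarith)
    have hsp : ss x₀ R p.1 < 1 / 2 := lt_of_le_of_ne hpC.1 (fun h => by
      have : phi x₀ R p.1 = 0 := by unfold phi kk; rw [h]; norm_num
      linarith)
    have hpball := hA hpC.1
    have hpI := hIcc _ hpC.2
    have hUp' := hUC p hpC
    have hf2 : ContDiff ℝ 2 f := by
      have : ∀ k : ℕ, ContDiff ℝ k f := fun k => hf.of_le (by exact_mod_cast le_top)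
      exact this 2
    have hfd : Differentiable ℝ f := hf2.differentiable (by norm_num)
    have hfd1 : ∀ v, Differentiable ℝ (dd v f) := fun v y =>
      (dd_contDiffAt (m := 1) (k := 2) (by norm_num) hf2.contDiffAt v).differentiableAt (by norm_num)
    have hφd : Differentiable ℝ (phi x₀ R) := (phi_contDiff x₀ R).differentiable (by norm_num)
    have hφd1 : ∀ v, Differentiable ℝ (dd v (phi x₀ R)) := fun v y =>
      (dd_contDiffAt (m := 1) (k := 2) (by norm_num) (phi_contDiff x₀ R).contDiffAt v).differentiableAt
        (by norm_num)
    have hFe : ∀ i, dd (e i) Fp = fun y => dd (EuclideanSpace.single i (1:ℝ)) f y.1 := fun i =>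
      funext fun y => dd_fst _ _ _ (hfd _)
    have hFee : ∀ i j y, dd (e j) (dd (e i) Fp) y =
        dd (EuclideanSpace.single j (1:ℝ)) (dd (EuclideanSpace.single i (1:ℝ)) f) y.1 := by
      intro i j y
      rw [hFe]; exact dd_fst _ _ _ (hfd1 _ _)
    have dφ1 : ∀ y : EuclideanSpace ℝ (Fin n) × ℝ, DifferentiableAt ℝ (fun y : EuclideanSpace ℝ (Fin n) × ℝ => phi x₀ R y.1) y :=
      fun y => (hφd _).comp y differentiableAt_fst
    have dφ2 : ∀ v, ∀ y : EuclideanSpace ℝ (Fin n) × ℝ, DifferentiableAt ℝ (fun y : EuclideanSpace ℝ (Fin n) × ℝ => dd v (phi x₀ R) y.1) y :=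
      fun v y => (hφd1 v _).comp y differentiableAt_fst
    have ds : ∀ y : EuclideanSpace ℝ (Fin n) × ℝ, DifferentiableAt ℝ (fun y : EuclideanSpace ℝ (Fin n) × ℝ => y.2 - s₀) y :=
      fun y => differentiableAt_snd.sub_const _
    have hΨe : ∀ i, dd (e i) Ψ = fun y => (y.2 - s₀) * dd (EuclideanSpace.single i (1:ℝ)) (phi x₀ R) y.1 := by
      intro i
      funext y
      simp only [Ψ, e]
      rw [dd_mul _ (ds y) (dφ1 y), dd_snd, dd_fst _ _ _ (hφd _)]; simp
    have hΨee : ∀ i, dd (e i) (dd (e i) Ψ) p = (p.2 - s₀) *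
        dd (EuclideanSpace.single i (1:ℝ)) (dd (EuclideanSpace.single i (1:ℝ)) (phi x₀ R)) p.1 := by
      intro i
      rw [hΨe, dd_mul _ (ds p) (dφ2 _ p), dd_snd, dd_fst _ _ _ (hφd1 _ _)]; simp
    have hΨt : dd et Ψ p = phi x₀ R p.1 := by
      simp only [Ψ, et]
      rw [dd_mul _ (ds p) (dφ1 p), dd_snd, dd_fst _ _ _ (hφd _)]; simp [dd]
    have hnear : ∀ᶠ y in nhds p, y.1 ∈ A ∧ y.1 ∈ ball x₀ R ∧ y.2 ∈ Ioo (t₀ - T) t₀ ∧ s₀ ≤ y.2 := by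
      have h1 : ∀ᶠ y in nhds p, ss x₀ R y.1 < 1 / 2 :=
        (hss.comp continuous_fst).continuousAt.eventually_lt continuousAt_const hsp
      have h2 : ∀ᶠ y in nhds p, y.2 ∈ Ioo (t₀ - T) t₀ :=
        continuousAt_snd.eventually_mem (Ioo_mem_nhds hpI.1 hpI.2)
      have h3 : ∀ᶠ y in nhds p, s₀ < y.2 :=
        continuousAt_const.eventually_lt continuousAt_snd (by linarith)
      filter_upwards [h1, h2, h3] with y a b c
      exact ⟨le_of_lt a, hA (le_of_lt a), b, c.le⟩
    have key := maxpoint e et U Fp Ψ p a (((n:ℝ) - 1) * K) c₁ M hUp'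
      (hf.contDiffAt.comp p contDiffAt_fst) hΨC.contDiffAt hΨp hUp hqp
      (by
        filter_upwards [hnear] with y hy
        have := hpde y.1 hy.2.1 y.2 hy.2.2.1
        simp only [hFe]
        exact this)
      (by
        have h := hess p.1 hpball (WithLp.toLp 2 (fun j => dd (e j) U p))
        rw [hess_expand hf2, EuclideanSpace.norm_sq_eq] at h
        simp only [Real.norm_eq_abs, sq_abs] at h
        simp_rw [hFee]
        have e5 : -(((n:ℝ) - 1) * K) = -((n:ℝ) - 1) * K := by ring
        rw [e5]
        exact h)
      (by
        refine le_trans ?_ (le_max_left _ _)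
        have : Real.log (U p) ≤ Real.log D := Real.log_le_log hUp hUpD
        have := mul_le_mul_of_nonneg_left this ha
        linarith)
      hM
      (by
        intro i
        filter_upwards [(line_tendsto p (e i)).eventually hnear] with s hs
        apply hmaxC
        refine ⟨hs.1, ?_⟩
        have : (p + s • e i).2 = p.2 := by simp [e]
        rw [this]; exact hpC.2)
      (by
        filter_upwards [((line_tendsto p et).mono_left nhdsWithin_le_nhds).eventually hnear,
          self_mem_nhdsWithin] with s hs hs0
        apply hmaxC
        refine ⟨hs.1, hs.2.2.2, ?_⟩
        have : (p + s • et).2 = p.2 + s := by simp [et]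
        rw [this]
        have : s < 0 := hs0
        linarith [hpC.2.2])
    obtain ⟨b1, b2, b3⟩ := phi_bounds hn f x₀ R K hf hR hK hess p.1 hpball hpC.1
    simp_rw [hΨee, hΨe, hΨt, hFe, mul_pow] at key
    have e3 : ∑ i, dd (EuclideanSpace.single i (1:ℝ)) f p.1 *
        ((p.2 - s₀) * dd (EuclideanSpace.single i (1:ℝ)) (phi x₀ R) p.1)
        = (p.2 - s₀) * ∑ i, dd (EuclideanSpace.single i (1:ℝ)) f p.1 *
        dd (EuclideanSpace.single i (1:ℝ)) (phi x₀ R) p.1 := by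
      rw [Finset.mul_sum]; exact Finset.sum_congr rfl fun i _ => by ring
    rw [← Finset.mul_sum, ← Finset.mul_sum, e3] at key
    have e4 : (p.2 - s₀) ^ 2 * (∑ i, dd (EuclideanSpace.single i (1:ℝ)) (phi x₀ R) p.1 ^ 2) / Ψ p
        ≤ (p.2 - s₀) * (576 / R ^ 2) := by
      rw [div_le_iff₀ hΨp]
      calc _ ≤ (p.2 - s₀) ^ 2 * (576 / R ^ 2 * phi x₀ R p.1) := by gcongr
        _ = _ := by simp only [Ψ]; ring
    have e6 : c₁ * Ψ p ≤ (p.2 - s₀) * c₁ := by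
      have : Ψ p ≤ p.2 - s₀ := mul_le_of_le_one_right hτ0 hφ1
      rw [mul_comm]; exact mul_le_mul_of_nonneg_right this hc₁0
    have c1 := mul_le_mul_of_nonneg_left b1 hτ0
    have c3 := mul_le_mul_of_nonneg_left b3 hτ0
    have e7 : (p.2 - s₀) * B = (p.2 - s₀) * c₁ + (p.2 - s₀) * ((192 + 24 * n) / R ^ 2)
      + 5 / 2 * ((p.2 - s₀) * (576 / R ^ 2))
      + (p.2 - s₀) * (24 * (|alphaC f x₀| / R) + 24 * n * K) := by rw [hB]; ring
    have e8 : (p.2 - s₀) * B ≤ (t - s₀) * B := mul_le_mul_of_nonneg_right hτt hB0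
    have hfin : 0 ≤ 1 + (t - s₀) * B := by
      have : 0 ≤ t - s₀ := by linarith
      positivity
    calc M ≤ 4 * U p * (1 + (t - s₀) * B) := by
          refine key.trans ?_
          apply mul_le_mul_of_nonneg_left _ (by positivity)
          linarith
      _ ≤ 4 * D * (1 + (t - s₀) * B) := by gcongr
  have hτ : t - s₀ = (t - t₀ + T) / 2 := by rw [hs₀]; ring
  have hτ0 : 0 < t - s₀ := by linarith
  have h1 : (t - s₀) * q (x, t) ≤ (4 * D * (1 + (t - s₀) * B)) * U (x, t) :=
    hxt.trans (mul_le_mul_of_nonneg_right hMb hUxt.le)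
  have h2 : q (x, t) ≤ 4 * D * U (x, t) * (2 * (1 / (t - t₀ + T)) + B) := by
    have : (4 * D * (1 + (t - s₀) * B)) * U (x, t)
      = (t - s₀) * (4 * D * U (x, t) * (2 * (1 / (t - t₀ + T)) + B)) := by
      rw [hτ]; field_simp
    rw [this] at h1
    exact le_of_mul_le_mul_left h1 hτ0
  have h3 : 2 * (1 / (t - t₀ + T)) + B ≤ (1632 + 24 * n) * S := by
    have i1 : 0 ≤ 1 / R ^ 2 := by positivity
    have i2 : 0 ≤ |alphaC f x₀| / R := by positivity
    have i3 : 0 ≤ 1 / (t - t₀ + T) := by positivity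
    have i4 : 0 ≤ (n:ℝ) * (|alphaC f x₀| / R) := by positivity
    have i5 : 0 ≤ (n:ℝ) * (1 / (t - t₀ + T)) := by positivity
    have i6 : 0 ≤ (n:ℝ) * c₁ := by positivity
    have i7 : (1632 + 24 * (n:ℝ)) / R ^ 2 = (1632 + 24 * n) * (1 / R ^ 2) := by ring
    rw [hB, hS, i7]
    nlinarith
  calc q (x, t) ≤ 4 * D * U (x, t) * (2 * (1 / (t - t₀ + T)) + B) := h2
    _ ≤ 4 * D * U (x, t) * ((1632 + 24 * n) * S) := by gcongr
    _ = _ := by ring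

/-- Hamilton-type gradient estimate for the nonlinear `f`-heat equation, case `a ≥ 0`
(Euclidean case of Theorem 1.1(i)). -/
theorem hamilton_gradient_estimate_nonneg (n : ℕ) (hn : 1 ≤ n) :
    ∃ c : ℝ, 0 < c ∧
      ∀ (f : EuclideanSpace ℝ (Fin n) → ℝ) (x₀ : EuclideanSpace ℝ (Fin n))
        (R K t₀ T a D : ℝ) (u : EuclideanSpace ℝ (Fin n) → ℝ → ℝ),
        ContDiff ℝ (⊤ : ℕ∞) f →
        2 ≤ R → 0 ≤ K → 0 < T → 0 ≤ a → 0 < D →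
        (∀ x ∈ ball x₀ R, ∀ v : EuclideanSpace ℝ (Fin n),
          hessQF f x v ≥ -((n : ℝ) - 1) * K * ‖v‖ ^ 2) →
        ContDiffOn ℝ (⊤ : ℕ∞) (fun p : EuclideanSpace ℝ (Fin n) × ℝ => u p.1 p.2)
          (ball x₀ R ×ˢ Icc (t₀ - T) t₀) →
        (∀ x ∈ ball x₀ R, ∀ t ∈ Icc (t₀ - T) t₀, 0 < u x t ∧ u x t ≤ D) →
        (∀ x ∈ ball x₀ R, ∀ t ∈ Icc (t₀ - T) t₀,
          deriv (fun s => u x s) t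
            = fLap f (fun y => u y t) x + a * u x t * Real.log (u x t)) →
        ∀ x ∈ ball x₀ (R / 2), ∀ t ∈ Ioc (t₀ - T) t₀,
          ‖gradient (fun y => u y t) x‖ / Real.sqrt (u x t) ≤
            c * Real.sqrt D *
              (1 / R + Real.sqrt (|alphaC f x₀| / R) + 1 / Real.sqrt (t - t₀ + T)
                + Real.sqrt K
                + Real.sqrt (max (2 * ((n : ℝ) - 1) * K + a * (2 + Real.log D)) 0)) := by
  have hn1 : (1:ℝ) ≤ n := by exact_mod_cast hn
  refine ⟨4 * (1632 + 24 * n), by positivity, ?_⟩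
  intro f x₀ R K t₀ T a D u hf hR hK hT ha hD hess hu hpos hpde x hx t ht
  set U : EuclideanSpace ℝ (Fin n) × ℝ → ℝ := fun p => u p.1 p.2 with hUdef
  have hxR : x ∈ ball x₀ R := ball_subset_ball (by linarith) hx
  have hUat : ∀ x ∈ ball x₀ R, ∀ t ∈ Ioo (t₀ - T) t₀, ContDiffAt ℝ (⊤ : ℕ∞) U (x, t) := by
    intro x hx t ht
    exact hu.contDiffAt (prod_mem_nhds (isOpen_ball.mem_nhds hx) (Icc_mem_nhds ht.1 ht.2))
  have hUd : ∀ x ∈ ball x₀ R, ∀ t ∈ Ioo (t₀ - T) t₀, DifferentiableAt ℝ U (x, t) :=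
    fun x hx t ht => (hUat x hx t ht).differentiableAt (by simp)
  have hest := interior_est hn f x₀ R K t₀ T a D U hf hR hK ha hD hess hUat
    (fun x hx t ht => hpos x hx t (Ioo_subset_Icc_self ht))
    (by
      intro x hx t ht
      have h := hpde x hx t (Ioo_subset_Icc_self ht)
      rw [← slice_t (hUd x hx t ht)]
      have e0 : ∀ v, dd v (fun y => u y t) =ᶠ[nhds x] fun y => dd (v, (0:ℝ)) U (y, t) := by
        intro v
        filter_upwards [isOpen_ball.mem_nhds hx] with y hy
        exact slice_x v (hUd y hy t ht)
      have e1 : eLap (fun y => u y t) x = ∑ i, dd (EuclideanSpace.single i (1:ℝ), (0:ℝ))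
            (dd (EuclideanSpace.single i (1:ℝ), (0:ℝ)) U) (x, t) := by
        unfold eLap
        refine Finset.sum_congr rfl fun i _ => ?_
        have h2 := dd_congr (EuclideanSpace.single i (1:ℝ)) (e0 (EuclideanSpace.single i (1:ℝ)))
        have hk : ∀ k : ℕ, ContDiffAt ℝ k U (x, t) := fun k =>
          (hUat x hx t ht).of_le (by exact_mod_cast le_top)
        have h3 := slice_x (U := dd (EuclideanSpace.single i (1:ℝ), (0:ℝ)) U) (x := x) (t := t)
          (EuclideanSpace.single i (1:ℝ))
          ((dd_contDiffAt (m := 1) (k := 2) (by norm_num) (hk 2) _).differentiableAt (by norm_num))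
        exact h2.trans h3
      have e2 : ∀ i, dd (EuclideanSpace.single i (1:ℝ)) (fun y => u y t) x
          = dd (EuclideanSpace.single i (1:ℝ), (0:ℝ)) U (x, t) := fun i => (e0 _).self_of_nhds
      unfold fLap at h
      rw [e1, inner_gradient] at h
      simp_rw [e2] at h
      rw [← mul_assoc]
      exact h)
  -- slices up to the boundary
  set Q : Set (EuclideanSpace ℝ (Fin n) × ℝ) := ball x₀ R ×ˢ Icc (t₀ - T) t₀ with hQ
  have hslice : ∀ s ∈ Icc (t₀ - T) t₀, ∀ v : EuclideanSpace ℝ (Fin n),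
      dd v (fun y => u y s) x = fderivWithin ℝ U Q (x, s) (v, 0) := by
    intro s hs v
    have h1 := ((hu (x, s) ⟨hxR, hs⟩).differentiableWithinAt (by simp)).hasFDerivWithinAt
    have h2 : HasFDerivWithinAt (fun y : EuclideanSpace ℝ (Fin n) => (y, s)) _ (ball x₀ R) x :=
      (hasFDerivAt_prodMk_left (𝕜 := ℝ) x s).hasFDerivWithinAt
    have h3 := HasFDerivWithinAt.comp x h1 h2
      (show MapsTo (fun y : EuclideanSpace ℝ (Fin n) => (y, s)) (ball x₀ R) Q from fun y hy => ⟨hy, hs⟩)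
    have h4 : HasFDerivAt (fun y => u y s) _ x := h3.hasFDerivAt (isOpen_ball.mem_nhds hxR)
    unfold dd
    rw [h4.fderiv]; simp [hUdef, hQ]
  have hline : ContinuousOn (fun s : ℝ => (x, s)) (Icc (t₀ - T) t₀) := by fun_prop
  have hmaps : MapsTo (fun s : ℝ => (x, s)) (Icc (t₀ - T) t₀) Q := fun s hs => ⟨hxR, hs⟩
  have hfc : ContinuousOn (fun s => fderivWithin ℝ U Q (x, s)) (Icc (t₀ - T) t₀) :=
    (hu.continuousOn_fderivWithin (isOpen_ball.uniqueDiffOn.prod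
      (uniqueDiffOn_Icc (by linarith))) (by simp)).comp hline hmaps
  have huc : ContinuousOn (fun s => U (x, s)) (Icc (t₀ - T) t₀) := hu.continuousOn.comp hline hmaps
  have hmain : ‖gradient (fun y => u y t) x‖ ^ 2 ≤ (4 * (1632 + 24 * n)) * D * U (x, t) *
        (1 / R ^ 2 + |alphaC f x₀| / R + 1 / (t - t₀ + T) + K
          + max (2 * ((n : ℝ) - 1) * K + a * (2 + Real.log D)) 0) := by
    have htI : t ∈ Icc (t₀ - T) t₀ := Ioc_subset_Icc_self ht
    rw [norm_gradient_sq]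
    simp_rw [hslice t htI]
    have hsub : Ioo (t₀ - T) t₀ ⊆ Icc (t₀ - T) t₀ := Ioo_subset_Icc_self
    refine ContinuousWithinAt.closure_le (s := Ioo (t₀ - T) t₀)
      (f := fun t => ∑ i, (fderivWithin ℝ U Q (x, t) (EuclideanSpace.single i (1:ℝ), (0:ℝ))) ^ 2)
      (g := fun t => (4 * (1632 + 24 * n)) * D * U (x, t) *
        (1 / R ^ 2 + |alphaC f x₀| / R + 1 / (t - t₀ + T) + K
          + max (2 * ((n : ℝ) - 1) * K + a * (2 + Real.log D)) 0))
      (by rw [closure_Ioo (by linarith)]; exact htI) ?_ ?_ ?_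
    · apply tendsto_finsetSum
      intro i _
      exact (((hfc t htI).mono hsub).clm_apply continuousWithinAt_const).pow 2
    · have h1 : ContinuousAt (fun t : ℝ => 1 / (t - t₀ + T)) t := by
        apply ContinuousAt.div continuousAt_const (by fun_prop)
        linarith [ht.1]
      exact (continuousWithinAt_const.mul ((huc t htI).mono hsub)).mul
        (((continuousWithinAt_const.add h1.continuousWithinAt).add continuousWithinAt_const).add
          continuousWithinAt_const)
    · intro s hs
      have h := hest x hx s hs
      refine le_trans (le_of_eq ?_) h
      refine Finset.sum_congr rfl fun i _ => ?_
      rw [← hslice s (hsub hs), ← slice_x _ (hUd x hxR s hs)]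
  have hup : 0 < u x t := (hpos x hxR t (Ioc_subset_Icc_self ht)).1
  have htT : 0 < t - t₀ + T := by linarith [ht.1]
  have hR0 : 0 < R := by linarith
  set c₁ := max (2 * ((n : ℝ) - 1) * K + a * (2 + Real.log D)) 0 with hc₁
  have hc₁0 : 0 ≤ c₁ := le_max_right _ _
  have hαR : 0 ≤ |alphaC f x₀| / R := by positivity
  set X := 1 / R + Real.sqrt (|alphaC f x₀| / R) + 1 / Real.sqrt (t - t₀ + T)
                + Real.sqrt K + Real.sqrt c₁ with hX
  have hS : 1 / R ^ 2 + |alphaC f x₀| / R + 1 / (t - t₀ + T) + K + c₁ ≤ X ^ 2 := by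
    have j1 : 0 ≤ 1 / R := by positivity
    have j2 := Real.sqrt_nonneg (|alphaC f x₀| / R)
    have j3 : 0 ≤ 1 / Real.sqrt (t - t₀ + T) := by positivity
    have j4 := Real.sqrt_nonneg K
    have j5 := Real.sqrt_nonneg c₁
    have s1 : 1 / R ^ 2 = (1 / R) ^ 2 := by ring
    have s2 := Real.sq_sqrt hαR
    have s3 : 1 / (t - t₀ + T) = (1 / Real.sqrt (t - t₀ + T)) ^ 2 := by
      rw [div_pow, Real.sq_sqrt htT.le, one_pow]
    have s4 := Real.sq_sqrt hK
    have s5 := Real.sq_sqrt hc₁0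
    rw [s1, s3]
    nth_rewrite 1 [← s2, ← s4, ← s5]
    rw [hX]
    generalize 1 / R = b1 at *
    generalize Real.sqrt (|alphaC f x₀| / R) = b2 at *
    generalize 1 / Real.sqrt (t - t₀ + T) = b3 at *
    generalize Real.sqrt K = b4 at *
    generalize Real.sqrt c₁ = b5 at *
    have : (b1 + b2 + b3 + b4 + b5) ^ 2 = b1 ^ 2 + b2 ^ 2 + b3 ^ 2 + b4 ^ 2 + b5 ^ 2
      + 2 * (b1 * (b2 + b3 + b4 + b5) + b2 * (b3 + b4 + b5) + b3 * (b4 + b5) + b4 * b5) := by ring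
    rw [this]
    have : 0 ≤ 2 * (b1 * (b2 + b3 + b4 + b5) + b2 * (b3 + b4 + b5) + b3 * (b4 + b5) + b4 * b5) := by
      positivity
    linarith
  have hX0 : 0 ≤ X := by positivity
  set C : ℝ := 4 * (1632 + 24 * n) with hC
  have hC1 : 1 ≤ C := by rw [hC]; linarith
  rw [← sq_le_sq₀ (by positivity) (by positivity), div_pow, Real.sq_sqrt hup.le, div_le_iff₀ hup,
    mul_pow, mul_pow, Real.sq_sqrt hD.le]
  have hCC : C ≤ C ^ 2 := by nlinarith
  calc _ ≤ C * D * u x t * (1 / R ^ 2 + |alphaC f x₀| / R + 1 / (t - t₀ + T) + K + c₁) := hmain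
    _ ≤ C ^ 2 * D * u x t * X ^ 2 := by gcongr
    _ = _ := by ring
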